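/- Let y = v_j be a vertex and i an index with i > j. For a left-pseudo-bipartite scenario s, let Q(s) denote the number of right clusters for y under s that strictly follow (lie entirely to the right of) the right cluster for y containing v_i. Then the number of weights ω in the open interval (w_i^−, w_i^+) at which the right-cluster partition for y under s(i, ·) is not locally constant is at most Q(s(i, w_i^−)) − Q(s(i, w_i^+)). -/

import Mathlib

open Finset
open scoped Classical

namespace DPN

noncomputable def score (τ c : ℝ) (v w : ℕ → ℝ) (h r j : ℕ) : ℝ :=
  τ * (v h - v j) + (∑ l ∈ Finset.Ioc r j, w l) / c

noncomputable def nextHead (τ c : ℝ) (v w : ℕ → ℝ) (h r : ℕ) : ℕ :=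
  (((Finset.Ioc r h).filter (fun j =>
      ∀ j' ∈ Finset.Ioc r h, score τ c v w h r j' ≤ score τ c v w h r j)).max).getD h

noncomputable def heads (τ c : ℝ) (v w : ℕ → ℝ) (h : ℕ) : ℕ → ℕ
  | 0 => 0
  | m + 1 => nextHead τ c v w h (heads τ c v w h m)

noncomputable def hIdx (n : ℕ) (v : ℕ → ℝ) (x : ℝ) : ℕ :=
  ((Finset.Icc 1 n).filter (fun i => v i < x)).card

noncomputable def phiL (n : ℕ) (τ c : ℝ) (v w : ℕ → ℝ) (x : ℝ) : ℝ :=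
  ∑ m ∈ Finset.range n,
    ((∑ l ∈ Finset.Ioc (heads τ c v w (hIdx n v x) m) (heads τ c v w (hIdx n v x) (m + 1)), w l) *
        (τ * (x - v (heads τ c v w (hIdx n v x) (m + 1)))) +
      (∑ l ∈ Finset.Ioc (heads τ c v w (hIdx n v x) m) (heads τ c v w (hIdx n v x) (m + 1)), w l) ^ 2 /
        (2 * c))

def rv (n : ℕ) (v : ℕ → ℝ) : ℕ → ℝ := fun l => -v (n + 1 - l)

def rw (n : ℕ) (w : ℕ → ℝ) : ℕ → ℝ := fun l => w (n + 1 - l)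

noncomputable def phiR (n : ℕ) (τ c : ℝ) (v w : ℕ → ℝ) (x : ℝ) : ℝ :=
  phiL n τ c (rv n v) (rw n w) (-x)

noncomputable def phi (n : ℕ) (τ c : ℝ) (v w : ℕ → ℝ) (x : ℝ) : ℝ :=
  phiL n τ c v w x + phiR n τ c v w x

/-- The set of scenarios: each vertex weight lies in its interval. -/
def scenarios (n : ℕ) (wm wp : ℕ → ℝ) : Set (ℕ → ℝ) :=
  {s | ∀ i, 1 ≤ i → i ≤ n → wm i ≤ s i ∧ s i ≤ wp i}

/-- The gap `Γ^s(x, y) = Φ^s(x) − Φ^s(y)`. -/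
noncomputable def gap (n : ℕ) (τ c : ℝ) (v s : ℕ → ℝ) (x y : ℝ) : ℝ :=
  phi n τ c v s x - phi n τ c v s y

/-- The regret `R^s(x) = Φ^s(x) − Φ^s(m^s)` (`Φ^s(m^s)` = min of `Φ^s` on `[v_1, v_n]`). -/
noncomputable def regret (n : ℕ) (τ c : ℝ) (v s : ℕ → ℝ) (x : ℝ) : ℝ :=
  phi n τ c v s x - sInf ((fun z => phi n τ c v s z) '' Set.Icc (v 1) (v n))

/-- The maximum regret `R_max(x) = sup_{s ∈ S} R^s(x)`. -/
noncomputable def maxRegret (n : ℕ) (τ c : ℝ) (v wm wp : ℕ → ℝ) (x : ℝ) : ℝ :=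
  sSup {r | ∃ s ∈ scenarios n wm wp, r = regret n τ c v s x}

/-- The left-pseudo-bipartite scenario `s(i, w)`. -/
def pseudoBipL (wm wp : ℕ → ℝ) (i : ℕ) (w : ℝ) : ℕ → ℝ :=
  fun l => if l < i then wp l else if l = i then w else wm l

/-- The right-pseudo-bipartite scenario `s(i, w)`. -/
def pseudoBipR (wm wp : ℕ → ℝ) (i : ℕ) (w : ℝ) : ℕ → ℝ :=
  fun l => if l < i then wm l else if l = i then w else wp l

/-- The head `ρ_m` of the left cluster containing vertex `i`: the smallest cluster head `≥ i`. -/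
noncomputable def clusterHeadOf (τ c : ℝ) (v w : ℕ → ℝ) (h i : ℕ) : ℕ :=
  ((((Finset.range (h + 1)).image (heads τ c v w h)).filter (fun r => i ≤ r)).min).getD h

/-- The head `ρ_{m−1}` preceding the left cluster containing vertex `i`:
the largest cluster head `< i`. -/
noncomputable def prevClusterHeadOf (τ c : ℝ) (v w : ℕ → ℝ) (h i : ℕ) : ℕ :=
  ((((Finset.range (h + 1)).image (heads τ c v w h)).filter (fun r => r < i)).max).getD 0

/-- The weight `σ_m` of the left cluster containing vertex `i`. -/
noncomputable def clusterWeightOf (τ c : ℝ) (v w : ℕ → ℝ) (h i : ℕ) : ℝ :=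
  ∑ l ∈ Finset.Ioc (prevClusterHeadOf τ c v w h i) (clusterHeadOf τ c v w h i), w l

/-- The sequence of right cluster heads for the vertex `y = v_j`
(expressed in the coordinates of the reflected network). -/
noncomputable def rightHeads (n : ℕ) (τ c : ℝ) (v w : ℕ → ℝ) (j : ℕ) : ℕ → ℕ :=
  heads τ c (rv n v) (rw n w) (hIdx n (rv n v) (-(v j)))

/-- The sequence of left cluster heads for the vertex `y = v_j`. -/
noncomputable def leftHeads (n : ℕ) (τ c : ℝ) (v w : ℕ → ℝ) (j : ℕ) : ℕ → ℕ :=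
  heads τ c v w (hIdx n v (v j))

/-- The (original-coordinates) index of the head of the right cluster for `y = v_j`
containing vertex `i`. -/
noncomputable def rightClusterHeadOf (n : ℕ) (τ c : ℝ) (v w : ℕ → ℝ) (j i : ℕ) : ℕ :=
  n + 1 - clusterHeadOf τ c (rv n v) (rw n w) (hIdx n (rv n v) (-(v j))) (n + 1 - i)

/-- The weight of the right cluster for `y = v_j` containing vertex `i`. -/
noncomputable def rightClusterWeightOf (n : ℕ) (τ c : ℝ) (v w : ℕ → ℝ) (j i : ℕ) : ℝ :=
  clusterWeightOf τ c (rv n v) (rw n w) (hIdx n (rv n v) (-(v j))) (n + 1 - i)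

/-- `ω` is a critical weight for `v_i` with respect to the vertex `y = v_j`
(left-pseudo-bipartite case): `ω ∈ {w_i^−, w_i^+}` or the right-cluster partition for `y`
under `s(i, ·)` is not constant on any neighborhood of `ω` in `[w_i^−, w_i^+]`. -/
def criticalWeightL (n : ℕ) (τ c : ℝ) (v wm wp : ℕ → ℝ) (j i : ℕ) (ω : ℝ) : Prop :=
  ω ∈ Set.Icc (wm i) (wp i) ∧
    (ω = wm i ∨ ω = wp i ∨
      ¬ ∃ ε > (0 : ℝ), ∀ w ∈ Set.Icc (wm i) (wp i), |w - ω| < ε →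
        rightHeads n τ c v (pseudoBipL wm wp i w) j =
          rightHeads n τ c v (pseudoBipL wm wp i ω) j)

/-- `ω` is a critical weight for `v_i` with respect to the vertex `y = v_j`
(right-pseudo-bipartite case, using the left-cluster partition for `y`). -/
def criticalWeightR (n : ℕ) (τ c : ℝ) (v wm wp : ℕ → ℝ) (j i : ℕ) (ω : ℝ) : Prop :=
  ω ∈ Set.Icc (wm i) (wp i) ∧
    (ω = wm i ∨ ω = wp i ∨
      ¬ ∃ ε > (0 : ℝ), ∀ w ∈ Set.Icc (wm i) (wp i), |w - ω| < ε →
        leftHeads n τ c v (pseudoBipR wm wp i w) j =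
          leftHeads n τ c v (pseudoBipR wm wp i ω) j)

/-- `Q`: the number of right clusters for `y = v_j` under weights `w` that lie entirely
to the right of the right cluster containing `v_i` (counted via reflected cluster heads). -/
noncomputable def Qnum (n : ℕ) (τ c : ℝ) (v w : ℕ → ℝ) (j i : ℕ) : ℕ :=
  (((Finset.range (n + 1)).image (rightHeads n τ c v w j)).filter
      (fun r => 1 ≤ r ∧
        r < clusterHeadOf τ c (rv n v) (rw n w) (hIdx n (rv n v) (-(v j))) (n + 1 - i))).card

end DPN

namespace DPN

/-- Up to a term independent of `l`, the score of `l`; it does not depend on the previous head. -/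
noncomputable def potential (τ c : ℝ) (v w : ℕ → ℝ) (l : ℕ) : ℝ :=
  (∑ p ∈ Finset.Ioc 0 l, w p) / c - τ * v l

/-- `l` strictly beats every later index up to `h`. -/
def IsRecord (F : ℕ → ℝ) (h l : ℕ) : Prop :=
  1 ≤ l ∧ l ≤ h ∧ ∀ l' ∈ Finset.Ioc l h, F l' < F l

lemma score_eq_potential (τ c : ℝ) (v w : ℕ → ℝ) (h : ℕ) {r l : ℕ} (hrl : r ≤ l) :
    score τ c v w h r l =
      potential τ c v w l + (τ * v h - (∑ p ∈ Finset.Ioc 0 r, w p) / c) := by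
  have hsum : ∑ p ∈ Finset.Ioc 0 l, w p =
      ∑ p ∈ Finset.Ioc 0 r, w p + ∑ p ∈ Finset.Ioc r l, w p :=
    (Finset.sum_Ioc_consecutive w (Nat.zero_le r) hrl).symm
  unfold score potential
  rw [hsum]
  ring

lemma nextHead_of_le (τ c : ℝ) (v w : ℕ → ℝ) {h r : ℕ} (hr : h ≤ r) :
    nextHead τ c v w h r = h := by
  unfold nextHead
  rw [Finset.Ioc_eq_empty (by omega)]
  rfl

lemma nextHead_spec (τ c : ℝ) (v w : ℕ → ℝ) {h r : ℕ} (hr : r < h) :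
    r < nextHead τ c v w h r ∧ IsRecord (potential τ c v w) h (nextHead τ c v w h r) ∧
      ∀ l ∈ Finset.Ioc r h,
        potential τ c v w l ≤ potential τ c v w (nextHead τ c v w h r) := by
  set S := (Finset.Ioc r h).filter (fun j =>
      ∀ j' ∈ Finset.Ioc r h, score τ c v w h r j' ≤ score τ c v w h r j) with hS
  have hmem : ∀ j, j ∈ S ↔ j ∈ Finset.Ioc r h ∧
      ∀ j' ∈ Finset.Ioc r h, potential τ c v w j' ≤ potential τ c v w j := by
    intro j
    rw [hS, Finset.mem_filter]
    refine and_congr_right fun hj => forall₂_congr fun j' hj' => ?_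
    rw [score_eq_potential τ c v w h (Finset.mem_Ioc.1 hj).1.le,
      score_eq_potential τ c v w h (Finset.mem_Ioc.1 hj').1.le, add_le_add_iff_right]
  have hne : S.Nonempty := by
    obtain ⟨j, hj, hjmax⟩ := Finset.exists_max_image (Finset.Ioc r h) (potential τ c v w)
      ⟨h, Finset.mem_Ioc.2 ⟨hr, le_rfl⟩⟩
    exact ⟨j, (hmem j).2 ⟨hj, hjmax⟩⟩
  obtain ⟨N, hN⟩ := Finset.max_of_nonempty hne
  have hval : nextHead τ c v w h r = N := by
    unfold nextHead
    rw [← hS, hN]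
    rfl
  rw [hval]
  obtain ⟨hNI, hNmax⟩ := (hmem N).1 (Finset.mem_of_max hN)
  rw [Finset.mem_Ioc] at hNI
  refine ⟨hNI.1, ⟨by omega, hNI.2, fun l hl => ?_⟩, hNmax⟩
  rw [Finset.mem_Ioc] at hl
  refine lt_of_le_of_ne (hNmax l (Finset.mem_Ioc.2 ⟨by omega, hl.2⟩)) fun heq => ?_
  have hlS : l ∈ S :=
    (hmem l).2 ⟨Finset.mem_Ioc.2 ⟨by omega, hl.2⟩, fun j' hj' => heq ▸ hNmax j' hj'⟩
  have := Finset.le_max_of_eq hlS hN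
  omega

lemma nextHead_le_of_isRecord (τ c : ℝ) (v w : ℕ → ℝ) {h r l : ℕ} (hrl : r < l)
    (hl : IsRecord (potential τ c v w) h l) : nextHead τ c v w h r ≤ l := by
  obtain ⟨-, hN, hmax⟩ := nextHead_spec τ c v w (lt_of_lt_of_le hrl hl.2.1)
  by_contra! hlt
  have h1 := hl.2.2 _ (Finset.mem_Ioc.2 ⟨hlt, hN.2.1⟩)
  have h2 := hmax l (Finset.mem_Ioc.2 ⟨hrl, hl.2.1⟩)
  linarith

/-- The heads depend only on which indices are records. -/
lemma heads_congr {τ c : ℝ} {v w₁ w₂ : ℕ → ℝ} {h : ℕ}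
    (H : ∀ l, IsRecord (potential τ c v w₁) h l ↔ IsRecord (potential τ c v w₂) h l) :
    heads τ c v w₁ h = heads τ c v w₂ h := by
  funext m
  induction m with
  | zero => rfl
  | succ m ih =>
    rw [heads, heads, ih]
    rcases lt_or_ge (heads τ c v w₂ h m) h with hr | hr
    · obtain ⟨h1, hR1, -⟩ := nextHead_spec τ c v w₁ hr
      obtain ⟨h2, hR2, -⟩ := nextHead_spec τ c v w₂ hr
      exact le_antisymm (nextHead_le_of_isRecord τ c v w₁ h2 ((H _).2 hR2))
        (nextHead_le_of_isRecord τ c v w₂ h1 ((H _).1 hR1))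
    · rw [nextHead_of_le τ c v w₁ hr, nextHead_of_le τ c v w₂ hr]

lemma isRecord_self (F : ℕ → ℝ) {h : ℕ} (hh : 1 ≤ h) : IsRecord F h h :=
  ⟨hh, le_rfl, fun l hl => by rw [Finset.mem_Ioc] at hl; omega⟩

lemma exists_heads_eq (τ c : ℝ) (v w : ℕ → ℝ) {h l : ℕ}
    (hl : IsRecord (potential τ c v w) h l) (m : ℕ) :
    (∃ k ≤ m, heads τ c v w h k = l) ∨ (m ≤ heads τ c v w h m ∧ heads τ c v w h m < l) := by
  induction m with
  | zero => exact Or.inr ⟨Nat.zero_le _, hl.1⟩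
  | succ m ih =>
    rcases ih with ⟨k, hk, hkl⟩ | ⟨hm, hlt⟩
    · exact Or.inl ⟨k, by omega, hkl⟩
    · have hle := nextHead_le_of_isRecord τ c v w hlt hl
      have hgt := (nextHead_spec τ c v w (lt_of_lt_of_le hlt hl.2.1)).1
      rcases hle.lt_or_eq with hlt' | heq
      · exact Or.inr (by rw [heads]; omega)
      · exact Or.inl ⟨m + 1, le_rfl, by rw [heads, heq]⟩

lemma mem_image_heads (τ c : ℝ) (v w : ℕ → ℝ) {h m l : ℕ} (hm : h ≤ m) (hl : 1 ≤ l) :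
    l ∈ (Finset.range (m + 1)).image (heads τ c v w h) ↔
      IsRecord (potential τ c v w) h l := by
  rw [Finset.mem_image]
  constructor
  · rintro ⟨k, -, rfl⟩
    cases k with
    | zero => exact absurd hl (by simp [heads])
    | succ k =>
      rw [heads] at hl ⊢
      rcases lt_or_ge (heads τ c v w h k) h with hr | hr
      · exact (nextHead_spec τ c v w hr).2.1
      · rw [nextHead_of_le τ c v w hr] at hl ⊢
        exact isRecord_self _ hl
  · intro hR
    rcases exists_heads_eq τ c v w hR m with ⟨k, hk, hkl⟩ | ⟨h1, h2⟩
    · exact ⟨k, Finset.mem_range.2 (by omega), hkl⟩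
    · have := hR.2.1
      omega

lemma clusterHeadOf_spec (τ c : ℝ) (v w : ℕ → ℝ) {h i : ℕ} (hi : 1 ≤ i) (hih : i ≤ h) :
    i ≤ clusterHeadOf τ c v w h i ∧
      ∀ l, IsRecord (potential τ c v w) h l → i ≤ l → clusterHeadOf τ c v w h i ≤ l := by
  set S := ((Finset.range (h + 1)).image (heads τ c v w h)).filter (fun r => i ≤ r) with hS
  have hmem : ∀ l, IsRecord (potential τ c v w) h l → i ≤ l → l ∈ S := fun l hl hil =>
    Finset.mem_filter.2 ⟨(mem_image_heads τ c v w le_rfl hl.1).2 hl, hil⟩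
  obtain ⟨K, hK⟩ := Finset.min_of_nonempty ⟨h, hmem h (isRecord_self _ (hi.trans hih)) hih⟩
  have hval : clusterHeadOf τ c v w h i = K := by
    unfold clusterHeadOf
    rw [← hS, hK]
    rfl
  rw [hval]
  exact ⟨(Finset.mem_filter.1 (Finset.mem_of_min hK)).2,
    fun l hl hil => Finset.min_le_of_eq (hmem l hl hil) hK⟩

lemma hIdx_rv {n : ℕ} {v : ℕ → ℝ} (hv : ∀ i, 1 ≤ i → i < n → v i < v (i + 1))
    {j : ℕ} (hj1 : 1 ≤ j) (hjn : j ≤ n) : hIdx n (rv n v) (-(v j)) = n - j := by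
  have hmono : StrictMonoOn v (Set.Icc 1 n) := by
    refine strictMonoOn_of_lt_add_one Set.ordConnected_Icc fun a _ ha ha' => ?_
    exact hv a ha.1 (Nat.lt_of_succ_le ha'.2)
  have hset : (Finset.Icc 1 n).filter (fun i => rv n v i < -(v j)) = Finset.Icc 1 (n - j) := by
    ext l
    simp only [Finset.mem_filter, Finset.mem_Icc, rv, neg_lt_neg_iff]
    constructor
    · rintro ⟨⟨h1, h2⟩, hlt⟩
      have := (hmono.lt_iff_lt ⟨hj1, hjn⟩ (⟨by omega, by omega⟩ : n + 1 - l ∈ Set.Icc 1 n)).1 hlt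
      omega
    · rintro ⟨h1, h2⟩
      exact ⟨⟨h1, by omega⟩, hmono ⟨hj1, hjn⟩ ⟨by omega, by omega⟩ (by omega)⟩
  unfold hIdx
  rw [hset, Nat.card_Icc, Nat.add_sub_cancel]

lemma potential_pseudoBipL (n : ℕ) (τ c : ℝ) (u wm wp : ℕ → ℝ) {i : ℕ} (hi : 1 ≤ i)
    (hin : i ≤ n) (x : ℝ) (l : ℕ) :
    potential τ c u (DPN.rw n (pseudoBipL wm wp i x)) l =
      potential τ c u (DPN.rw n (pseudoBipL wm wp i 0)) l +
        if n + 1 - i ≤ l then x / c else 0 := by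
  have hpt : ∀ p ∈ Finset.Ioc 0 l, DPN.rw n (pseudoBipL wm wp i x) p =
      DPN.rw n (pseudoBipL wm wp i 0) p + if p = n + 1 - i then x else 0 := by
    intro p _
    by_cases hp : p = n + 1 - i
    · simp [DPN.rw, pseudoBipL, hp, show n + 1 - (n + 1 - i) = i by omega]
    · have : n + 1 - p ≠ i := by omega
      simp [DPN.rw, pseudoBipL, hp, this]
  unfold potential
  rw [Finset.sum_congr rfl hpt, Finset.sum_add_distrib, Finset.sum_ite_eq']
  have hiff : n + 1 - i ∈ Finset.Ioc 0 l ↔ n + 1 - i ≤ l := by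
    rw [Finset.mem_Ioc]; omega
  simp only [hiff]
  split_ifs <;> ring

/-- Raising the tail of a potential from `I` on by `x / c` keeps the records at or after `I`,
and keeps an earlier record `l` exactly as long as `x` is below a threshold `t l`. -/
lemma exists_threshold {c : ℝ} (hc : 0 < c) (F : ℕ → ℝ) {h I : ℕ} (hI : I ≤ h) :
    ∃ t : ℕ → ℝ, ∀ x : ℝ, ∀ l,
      IsRecord (fun k => F k + if I ≤ k then x / c else 0) h l ↔
        (I ≤ l ∧ IsRecord F h l) ∨ (l < I ∧ IsRecord F (I - 1) l ∧ x < t l) := by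
  obtain ⟨M, hM, hMmax⟩ := Finset.exists_max_image (Finset.Icc I h) F
    ⟨I, Finset.mem_Icc.2 ⟨le_rfl, hI⟩⟩
  rw [Finset.mem_Icc] at hM
  refine ⟨fun l => c * (F l - F M), fun x l => ?_⟩
  have hlt : ∀ a, x < c * (a - F M) ↔ F M + x / c < a := fun a => by
    rw [← div_lt_iff₀' hc, lt_sub_iff_add_lt, add_comm]
  simp only [IsRecord, Finset.mem_Ioc, hlt]
  rcases le_or_gt I l with hl | hl
  · simp only [hl, hl.not_gt, if_true, true_and, false_and, or_false]
    refine and_congr_right fun _ => and_congr_right fun _ => forall₂_congr fun k hk => ?_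
    rw [if_pos (by omega), add_lt_add_iff_right]
  · simp only [hl, hl.not_ge, if_false, true_and, false_and, false_or, add_zero]
    constructor
    · rintro ⟨h1, h2, h3⟩
      refine ⟨⟨h1, by omega, fun k hk => ?_⟩, ?_⟩
      · have := h3 k (by omega)
        rwa [if_neg (by omega), add_zero] at this
      · have := h3 M (by omega)
        rwa [if_pos hM.1] at this
    · rintro ⟨⟨h1, h2, h3⟩, h4⟩
      refine ⟨h1, by omega, fun k hk => ?_⟩
      split_ifs with hk'
      · have := hMmax k (Finset.mem_Icc.2 ⟨hk', hk.2⟩)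
        linarith
      · rw [add_zero]
        exact h3 k (by omega)

/-- The records lost between `a` and `b` bound the number of thresholds inside `(a, b)`. -/
lemma ncard_le_of_subset_image (A : Finset ℕ) (t : ℕ → ℝ) {a b : ℝ} {B : Set ℝ}
    (hB : ∀ ω ∈ B, a < ω ∧ ω < b ∧ ∃ l ∈ A, t l = ω) :
    B.Finite ∧ B.ncard ≤ (A.filter (fun l => a < t l)).card -
      (A.filter (fun l => b < t l)).card := by
  have hsub : B ⊆ (((A.filter (fun l => a < t l)) \ (A.filter (fun l => b < t l))).image t :
      Finset ℝ) := by
    intro ω hω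
    obtain ⟨ha, hb, l, hl, rfl⟩ := hB ω hω
    simp only [Finset.coe_image, Set.mem_image, Finset.mem_coe, Finset.mem_sdiff,
      Finset.mem_filter]
    exact ⟨l, ⟨⟨hl, ha⟩, fun h => hb.not_gt h.2⟩, rfl⟩
  refine ⟨(Finset.finite_toSet _).subset hsub, ?_⟩
  rcases B.eq_empty_or_nonempty with rfl | ⟨ω, hω⟩
  · simp
  obtain ⟨ha, hb, -⟩ := hB ω hω
  refine (Set.ncard_le_ncard hsub (Finset.finite_toSet _)).trans ?_
  rw [Set.ncard_coe_finset]
  refine Finset.card_image_le.trans (Finset.card_sdiff_of_subset fun l hl => ?_).le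
  rw [Finset.mem_filter] at hl ⊢
  exact ⟨hl.1, by linarith [hl.2]⟩

end DPN

open DPN

theorem stmt17 (n : ℕ) (τ c : ℝ) (hτ : 0 < τ) (hc : 0 < c) (v : ℕ → ℝ)
    (hv : ∀ i, 1 ≤ i → i < n → v i < v (i + 1))
    (wm wp : ℕ → ℝ) (hwm : ∀ i, 1 ≤ i → i ≤ n → 0 < wm i)
    (hwmp : ∀ i, 1 ≤ i → i ≤ n → wm i ≤ wp i)
    (j : ℕ) (hj1 : 1 ≤ j) (hjn : j ≤ n)
    (i : ℕ) (hji : j < i) (hin : i ≤ n) :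
    {ω : ℝ | ω ∈ Set.Ioo (wm i) (wp i) ∧
        ¬ ∃ ε > (0 : ℝ), ∀ w ∈ Set.Icc (wm i) (wp i), |w - ω| < ε →
          rightHeads n τ c v (pseudoBipL wm wp i w) j =
            rightHeads n τ c v (pseudoBipL wm wp i ω) j}.Finite ∧
      {ω : ℝ | ω ∈ Set.Ioo (wm i) (wp i) ∧
        ¬ ∃ ε > (0 : ℝ), ∀ w ∈ Set.Icc (wm i) (wp i), |w - ω| < ε →
          rightHeads n τ c v (pseudoBipL wm wp i w) j =
            rightHeads n τ c v (pseudoBipL wm wp i ω) j}.ncard ≤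
        Qnum n τ c v (pseudoBipL wm wp i (wm i)) j i -
          Qnum n τ c v (pseudoBipL wm wp i (wp i)) j i := by
  have hidx := hIdx_rv hv hj1 hjn
  set h := n - j with hh
  set I := n + 1 - i with hI
  have hI1 : 1 ≤ I := by omega
  have hIh : I ≤ h := by omega
  set F := potential τ c (rv n v) (DPN.rw n (pseudoBipL wm wp i 0)) with hF
  obtain ⟨t, ht⟩ := exists_threshold hc F hIh
  have hrec : ∀ x l,
      IsRecord (potential τ c (rv n v) (DPN.rw n (pseudoBipL wm wp i x))) h l ↔
        (I ≤ l ∧ IsRecord F h l) ∨ (l < I ∧ IsRecord F (I - 1) l ∧ x < t l) := fun x l => by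
    rw [funext (potential_pseudoBipL n τ c (rv n v) wm wp (by omega : 1 ≤ i) hin x)]
    exact ht x l
  set A := (Finset.Ico 1 I).filter (IsRecord F (I - 1)) with hA
  have hmemA : ∀ l, l ∈ A ↔ l < I ∧ IsRecord F (I - 1) l := fun l => by
    rw [hA, Finset.mem_filter, Finset.mem_Ico]
    exact ⟨fun H => ⟨H.1.2, H.2⟩, fun H => ⟨⟨H.2.1, H.1⟩, H.2⟩⟩
  have hQ : ∀ x, Qnum n τ c v (pseudoBipL wm wp i x) j i =
      (A.filter (fun l => x < t l)).card := fun x => by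
    unfold Qnum rightHeads
    rw [hidx]
    congr 1
    ext l
    obtain ⟨hK, hKmin⟩ := clusterHeadOf_spec τ c (rv n v)
      (DPN.rw n (pseudoBipL wm wp i x)) hI1 hIh
    rw [Finset.mem_filter, Finset.mem_filter, hmemA]
    constructor
    · rintro ⟨hl, hl1, hlK⟩
      rw [mem_image_heads _ _ _ _ (by omega) hl1] at hl
      have hlI : l < I := by
        by_contra! hle
        exact (hKmin l hl hle).not_gt hlK
      rcases (hrec x l).1 hl with ⟨h1, -⟩ | ⟨h1, h2, h3⟩
      · omega
      · exact ⟨⟨h1, h2⟩, h3⟩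
    · rintro ⟨⟨h1, h2⟩, h3⟩
      exact ⟨(mem_image_heads _ _ _ _ (by omega) h2.1).2 ((hrec x l).2 (Or.inr ⟨h1, h2, h3⟩)),
        h2.1, lt_of_lt_of_le h1 hK⟩
  rw [hQ, hQ]
  refine ncard_le_of_subset_image A t ?_
  rintro ω ⟨hω, hbad⟩
  refine ⟨hω.1, hω.2, ?_⟩
  by_contra! hne
  have hev : ∀ᶠ w in nhds ω, ∀ l ∈ A, (w < t l ↔ ω < t l) := by
    rw [Filter.eventually_all_finset]
    intro l hl
    rcases lt_or_gt_of_ne (hne l hl) with hlt | hgt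
    · filter_upwards [eventually_gt_nhds hlt] with w hw
      exact iff_of_false hw.not_gt hlt.not_gt
    · filter_upwards [eventually_lt_nhds hgt] with w hw
      exact iff_of_true hw hgt
  obtain ⟨ε, hε, hball⟩ := Metric.eventually_nhds_iff.1 hev
  refine hbad ⟨ε, hε, fun w _ hw => ?_⟩
  unfold rightHeads
  rw [hidx]
  refine heads_congr fun l => ?_
  rw [hrec w, hrec ω]
  refine or_congr_right (and_congr_right fun h1 => and_congr_right fun h2 => ?_)
  exact hball (by rwa [Real.dist_eq]) l ((hmemA l).2 ⟨h1, h2⟩)
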